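/- (A priori bound for the discrete HJB equation, inequalities (77)–(78) in the proof of Proposition 6.) Let δ > 0. Let U be a matrix with 0 ≤ U_{i,j} ≤ Ū for all (i,j), and let m be a matrix with m_{i,j} ≥ 0 for all (i,j) and Σ_{i=1}^{N_x} m_{i,j} = 1 for every j. If a matrix Φ satisfies Φ_{i,j} = U_{i,j} + (1/(2δ)) Σ_{k=1}^{N_x} ((Φ_{k,j} − Φ_{i,j})₊)² m_{k,j} for all (i,j), then 0 ≤ Φ_{i,j} ≤ Ū for all (i,j). -/

import Mathlib

/-- **A priori bound for the discrete HJB equation** (inequalities (77)–(78)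
in the proof of Proposition 6). If
`Φ_{i,j} = U_{i,j} + (1/(2δ)) Σ_k ((Φ_{k,j} − Φ_{i,j})₊)² m_{k,j}` with
`0 ≤ U ≤ Ū`, `m ≥ 0` and unit column sums, then `0 ≤ Φ ≤ Ū`. -/
theorem stmt15
    (Nx Ny : ℕ) [NeZero Nx] [NeZero Ny]
    (Ubar δ : ℝ) (hUbar : 0 < Ubar) (hδ : 0 < δ)
    (Umat : Fin Nx → Fin Ny → ℝ)
    (hU : ∀ i j, 0 ≤ Umat i j ∧ Umat i j ≤ Ubar)
    (m : Fin Nx → Fin Ny → ℝ)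
    (hm : ∀ i j, 0 ≤ m i j) (hms : ∀ j, ∑ i, m i j = 1)
    (Φ : Fin Nx → Fin Ny → ℝ)
    (hΦ : ∀ i j, Φ i j = Umat i j +
      (1 / (2 * δ)) * ∑ k, (max (Φ k j - Φ i j) 0) ^ 2 * m k j) :
    ∀ i j, 0 ≤ Φ i j ∧ Φ i j ≤ Ubar := by
  intro i j
  constructor
  · rw [hΦ i j]
    have h1 : 0 ≤ ∑ k, (max (Φ k j - Φ i j) 0) ^ 2 * m k j :=
      Finset.sum_nonneg fun k _ => mul_nonneg (sq_nonneg _) (hm k j)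
    have h2 : 0 ≤ 1 / (2 * δ) := by positivity
    exact add_nonneg (hU i j).1 (mul_nonneg h2 h1)
  · obtain ⟨p, hp⟩ := Finite.exists_max (fun k => Φ k j)
    have h0 : ∑ k, (max (Φ k j - Φ p j) 0) ^ 2 * m k j = 0 := by
      refine Finset.sum_eq_zero fun k _ => ?_
      rw [max_eq_right (sub_nonpos.mpr (hp k))]
      ring
    have h1 := hΦ p j
    rw [h0] at h1
    have h2 := (hU p j).2
    have h3 : Φ i j ≤ Φ p j := hp i
    linarith
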